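/- arXiv:2203.16619 — 3 statements merged into one kernel-verified Lean document; each statement's English description precedes it below -/
import Mathlib

section
/- The scramble number of the rook graph K_6 □ K_6 equals 27. In particular, sn(K_6 □ K_6) is strictly greater than the order of the scramble S*_{6,6} whose eggs are all connected vertex subsets of size 5, which has order 24. -/
/-- Decidability of adjacency in a box product of simple graphs. -/
instance {α β : Type*} (G : SimpleGraph α) (H : SimpleGraph β) [DecidableEq α] [DecidableEq β]
    [DecidableRel G.Adj] [DecidableRel H.Adj] : DecidableRel (G □ H).Adj := fun _ _ =>
  decidable_of_iff _ SimpleGraph.boxProd_adj.symm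

/-- The two-dimensional rook graph `K_n □ K_m`: the box product of the complete graphs
on `n` and `m` vertices. -/
def rook (n m : ℕ) : SimpleGraph (Fin n × Fin m) :=
  (⊤ : SimpleGraph (Fin n)) □ (⊤ : SimpleGraph (Fin m))

instance (n m : ℕ) : DecidableRel (rook n m).Adj := by unfold rook; infer_instance

/-- A scramble on `G`: a collection of nonempty vertex subsets (eggs), each of which
induces a connected subgraph. -/
def IsScramble {V : Type*} (G : SimpleGraph V) (S : Set (Finset V)) : Prop :=
  ∀ E ∈ S, E.Nonempty ∧ (G.induce (E : Set V)).Connected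

/-- A hitting set of a scramble: a vertex set intersecting every egg. -/
def IsHittingSet {V : Type*} [DecidableEq V] (S : Set (Finset V)) (H : Finset V) : Prop :=
  ∀ E ∈ S, (E ∩ H).Nonempty

/-- The number of edges with one endpoint in `X` and the other outside `X`. -/
def cutSize {V : Type*} [Fintype V] [DecidableEq V] (G : SimpleGraph V) [DecidableRel G.Adj]
    (X : Finset V) : ℕ :=
  (Finset.univ.filter (fun p : V × V => G.Adj p.1 p.2 ∧ p.1 ∈ X ∧ p.2 ∉ X)).card

/-- The partition `(X, Xᶜ)` is an egg cut of `S` if some egg is contained in `X` and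
some egg is contained in `Xᶜ`. -/
def IsEggCut {V : Type*} [Fintype V] [DecidableEq V] (S : Set (Finset V)) (X : Finset V) : Prop :=
  (∃ E ∈ S, E ⊆ X) ∧ (∃ E ∈ S, E ⊆ Xᶜ)

/-- The order of a scramble: the minimum of the minimal hitting set size and the minimal
egg cut-set size (`⊤` if no hitting set/egg cut exists). -/
noncomputable def scrambleOrder {V : Type*} [Fintype V] [DecidableEq V] (G : SimpleGraph V)
    [DecidableRel G.Adj] (S : Set (Finset V)) : ℕ∞ :=
  min (sInf {k : ℕ∞ | ∃ H : Finset V, IsHittingSet S H ∧ (H.card : ℕ∞) = k})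
      (sInf {k : ℕ∞ | ∃ X : Finset V, IsEggCut S X ∧ (cutSize G X : ℕ∞) = k})

/-- The scramble number of a graph: the maximum order of a scramble on it. -/
noncomputable def scrambleNumber {V : Type*} [Fintype V] [DecidableEq V] (G : SimpleGraph V)
    [DecidableRel G.Adj] : ℕ∞ :=
  sSup {k : ℕ∞ | ∃ S : Set (Finset V), IsScramble G S ∧ scrambleOrder G S = k}

/-- The scramble `S*_{n,m}` on `K_n □ K_m` whose eggs are exactly the vertex subsets of
size `n - 1` inducing connected subgraphs. -/
def SStar (n m : ℕ) : Set (Finset (Fin n × Fin m)) :=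
  {E | E.card = n - 1 ∧ ((rook n m).induce (E : Set (Fin n × Fin m))).Connected}

open Finset SimpleGraph

lemma rook_adj {n m : ℕ} {x y : Fin n × Fin m} :
    (rook n m).Adj x y ↔ (x.1 ≠ y.1 ∧ x.2 = y.2) ∨ (x.2 ≠ y.2 ∧ x.1 = y.1) := by
  simp [rook, boxProd_adj]

lemma rook_adj_of_fst_eq {n m : ℕ} {x y : Fin n × Fin m} (hne : x ≠ y) (h : x.1 = y.1) :
    (rook n m).Adj x y :=
  rook_adj.2 (.inr ⟨fun h' => hne (Prod.ext h h'), h⟩)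

lemma rook_adj_of_snd_eq {n m : ℕ} {x y : Fin n × Fin m} (hne : x ≠ y) (h : x.2 = y.2) :
    (rook n m).Adj x y :=
  rook_adj.2 (.inl ⟨fun h' => hne (Prod.ext h' h), h⟩)

/-- The scramble whose eggs are all connected vertex subsets of size `k`. -/
def connectedSets {V : Type*} (G : SimpleGraph V) (k : ℕ) : Set (Finset V) :=
  {E | E.card = k ∧ (G.induce (E : Set V)).Connected}

lemma isScramble_connectedSets {V : Type*} (G : SimpleGraph V) {k : ℕ} (hk : 0 < k) :
    IsScramble G (connectedSets G k) := fun _ hE =>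
  ⟨card_pos.1 (hE.1 ▸ hk), hE.2⟩

section Order

variable {V : Type*} [Fintype V] [DecidableEq V] {G : SimpleGraph V} [DecidableRel G.Adj]
  {S : Set (Finset V)}

lemma scrambleOrder_le_card {H : Finset V} (hH : IsHittingSet S H) :
    scrambleOrder G S ≤ H.card :=
  (min_le_left _ _).trans (sInf_le ⟨H, hH, rfl⟩)

lemma scrambleOrder_le_cutSize {X : Finset V} (hX : IsEggCut S X) :
    scrambleOrder G S ≤ cutSize G X :=
  (min_le_right _ _).trans (sInf_le ⟨X, hX, rfl⟩)

lemma le_scrambleOrder {k : ℕ} (hH : ∀ H : Finset V, IsHittingSet S H → k ≤ H.card)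
    (hX : ∀ X : Finset V, IsEggCut S X → k ≤ cutSize G X) :
    (k : ℕ∞) ≤ scrambleOrder G S := by
  refine le_min (le_sInf ?_) (le_sInf ?_)
  · rintro _ ⟨H, h, rfl⟩
    exact_mod_cast hH H h
  · rintro _ ⟨X, h, rfl⟩
    exact_mod_cast hX X h

lemma cutSize_compl (X : Finset V) : cutSize G Xᶜ = cutSize G X := by
  unfold cutSize
  refine card_bij (fun p _ => p.swap) ?_ ?_ ?_
  · rintro ⟨a, b⟩ h
    simp only [mem_filter, mem_univ, true_and, mem_compl, not_not, Prod.swap] at h ⊢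
    exact ⟨h.1.symm, h.2.2, h.2.1⟩
  · intro a _ b _ h
    exact Prod.swap_injective h
  · rintro ⟨a, b⟩ h
    refine ⟨(b, a), ?_, rfl⟩
    simp only [mem_filter, mem_univ, true_and, mem_compl, not_not] at h ⊢
    exact ⟨h.1.symm, h.2.2, h.2.1⟩

lemma cutSize_le_card_mul {X : Finset V} {d : ℕ}
    (h : ∀ x ∈ X, #{y | G.Adj x y ∧ y ∉ X} ≤ d) : cutSize G X ≤ #X * d := by
  have : cutSize G X = ∑ x ∈ X, #{y | G.Adj x y ∧ y ∉ X} := by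
    rw [← card_sigma]
    unfold cutSize
    refine card_bij (fun p _ => ⟨p.1, p.2⟩) ?_ ?_ ?_
    · rintro ⟨a, b⟩ h
      simp_all
    · rintro ⟨a, b⟩ _ ⟨c, d⟩ _ h
      simpa using h
    · rintro ⟨a, b⟩ h
      exact ⟨(a, b), by simp_all, rfl⟩
  rw [this]
  exact sum_le_card_nsmul _ _ _ h

end Order

section Connected

variable {V : Type*} {G : SimpleGraph V}

lemma exists_adj_mem_of_connected_induce {E : Finset V} (hE : (G.induce (E : Set V)).Connected)
    (hcard : 1 < #E) {x : V} (hx : x ∈ E) : ∃ y ∈ E, G.Adj x y := by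
  obtain ⟨a, ha, b, hb, hab⟩ := one_lt_card.1 hcard
  have : Nontrivial (E : Set V) := ⟨⟨a, ha⟩, ⟨b, hb⟩, fun h => hab (congrArg Subtype.val h)⟩
  obtain ⟨y, hy⟩ := hE.preconnected.exists_adj_of_nontrivial ⟨x, hx⟩
  exact ⟨y, y.2, hy⟩

lemma eq_of_connected_induce {α : Type*} {E : Set V} (hE : (G.induce E).Connected) (f : V → α)
    (hf : ∀ x ∈ E, ∀ y ∈ E, G.Adj x y → f x = f y) {x y : V} (hx : x ∈ E) (hy : y ∈ E) :
    f x = f y := by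
  obtain ⟨w⟩ := hE.preconnected ⟨x, hx⟩ ⟨y, hy⟩
  have key : ∀ {a b : E}, (G.induce E).Walk a b → f a = f b := by
    intro a b w
    induction w with
    | nil => rfl
    | cons h _ ih => exact (hf _ (Subtype.coe_prop _) _ (Subtype.coe_prop _) h).trans ih
  exact key w

lemma connected_induce_insert [DecidableEq V] {C : Finset V}
    (hC : (G.induce (C : Set V)).Connected) {x y : V} (hx : x ∈ C) (h : G.Adj x y) :
    (G.induce ((insert y C : Finset V) : Set V)).Connected := by
  have := connected_induce_union (G := G) (s := C) (t := {y}) hC.preconnected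
    (.of_subsingleton) hx rfl h
  rwa [coe_insert, ← Set.union_singleton]

/-- A vertex set without connected subsets of size `k` splits off a nonempty part of size less
than `k` which is not adjacent to the rest. -/
lemma exists_isolated_subset [DecidableEq V] {k : ℕ} (hk : 1 < k) {T : Finset V}
    (hT : ∀ E ⊆ T, E ∉ connectedSets G k) (hne : T.Nonempty) :
    ∃ C ⊆ T, C.Nonempty ∧ #C < k ∧ ∀ x ∈ C, ∀ y ∈ T \ C, ¬ G.Adj x y := by
  classical
  obtain ⟨t, ht⟩ := hne
  let F : Finset (Finset V) :=
    {C ∈ T.powerset | C.Nonempty ∧ #C < k ∧ (G.induce (C : Set V)).Connected}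
  have hF : F.Nonempty := by
    refine ⟨{t}, ?_⟩
    have hc : (G.induce (({t} : Finset V) : Set V)).Connected := by
      rw [coe_singleton]
      exact ⟨.of_subsingleton⟩
    simpa [F] using ⟨ht, hk, hc⟩
  obtain ⟨C, hC, hmax⟩ := F.exists_max_image card hF
  simp only [F, mem_filter, mem_powerset] at hC hmax
  obtain ⟨hCT, hCne, hCk, hCc⟩ := hC
  refine ⟨C, hCT, hCne, hCk, fun x hx y hy hadj => ?_⟩
  rw [mem_sdiff] at hy
  have hc := connected_induce_insert hCc hx hadj
  have hsub : insert y C ⊆ T := insert_subset hy.1 hCT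
  have hcard : #(insert y C) = #C + 1 := card_insert_of_notMem hy.2
  rcases Nat.lt_or_ge (#C + 1) k with h | h
  · have := hmax (insert y C) ⟨hsub, insert_nonempty _ _, hcard ▸ h, hc⟩
    omega
  · exact hT _ hsub ⟨by omega, hc⟩

end Connected

section Rook

variable {n m : ℕ}

lemma card_le_card_image_mul (X : Finset (Fin n × Fin m)) :
    #X ≤ #(X.image Prod.fst) * #(X.image Prod.snd) := by
  rw [← card_product]
  exact card_le_card fun x hx =>
    mem_product.2 ⟨mem_image_of_mem _ hx, mem_image_of_mem _ hx⟩

/-- A vertex set without connected subsets of size `k` is small in terms of the number of rows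
and columns it meets, as soon as this holds for all sets of size less than `k`. -/
lemma mul_card_le_of_forall_notMem_connectedSets {k a b : ℕ} (hk : 1 < k)
    (hab : ∀ s p q, s < k → s ≤ p * q → a * s ≤ b * (p + q)) (T : Finset (Fin n × Fin m))
    (hT : ∀ E ⊆ T, E ∉ connectedSets (rook n m) k) :
    a * #T ≤ b * (#(T.image Prod.fst) + #(T.image Prod.snd)) := by
  induction T using Finset.strongInduction with
  | H T ih =>
    rcases T.eq_empty_or_nonempty with rfl | hne
    · simp
    obtain ⟨C, hCT, hCne, hCk, hC⟩ := exists_isolated_subset hk hT hne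
    have h₁ := ih (T \ C) (sdiff_ssubset hCT hCne) fun E hE => hT E (hE.trans sdiff_subset)
    have h₂ := hab #C _ _ hCk (card_le_card_image_mul C)
    have hcard := card_sdiff_add_card_eq_card hCT
    have hne' : ∀ x ∈ C, ∀ y ∈ T \ C, x ≠ y := by
      rintro x hx y hy rfl
      exact (mem_sdiff.1 hy).2 hx
    have hrow : #(T.image Prod.fst) = #((T \ C).image Prod.fst) + #(C.image Prod.fst) := by
      rw [← card_union_of_disjoint, ← image_union, sdiff_union_of_subset hCT]
      refine disjoint_left.2 fun i hi hi' => ?_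
      obtain ⟨y, hy, rfl⟩ := mem_image.1 hi
      obtain ⟨x, hx, hxy⟩ := mem_image.1 hi'
      exact hC x hx y hy (rook_adj_of_fst_eq (hne' x hx y hy) hxy)
    have hcol : #(T.image Prod.snd) = #((T \ C).image Prod.snd) + #(C.image Prod.snd) := by
      rw [← card_union_of_disjoint, ← image_union, sdiff_union_of_subset hCT]
      refine disjoint_left.2 fun i hi hi' => ?_
      obtain ⟨y, hy, rfl⟩ := mem_image.1 hi
      obtain ⟨x, hx, hxy⟩ := mem_image.1 hi'
      exact hC x hx y hy (rook_adj_of_snd_eq (hne' x hx y hy) hxy)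
    rw [hrow, hcol, ← hcard]
    linarith

lemma mul_card_compl_le_of_isHittingSet {k a b : ℕ} (hk : 1 < k)
    (hab : ∀ s p q, s < k → s ≤ p * q → a * s ≤ b * (p + q)) {H : Finset (Fin n × Fin m)}
    (hH : IsHittingSet (connectedSets (rook n m) k) H) :
    a * #Hᶜ ≤ b * (n + m) := by
  refine (mul_card_le_of_forall_notMem_connectedSets hk hab Hᶜ fun E hE hE' => ?_).trans ?_
  · obtain ⟨x, hx⟩ := hH E hE'
    rw [mem_inter] at hx
    exact mem_compl.1 (hE hx.1) hx.2
  · gcongr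
    · exact (card_le_univ _).trans_eq (Fintype.card_fin n)
    · exact (card_le_univ _).trans_eq (Fintype.card_fin m)

/-- The edges of a cut of the rook graph, counted line by line. -/
lemma cutSize_rook (X : Finset (Fin n × Fin m)) :
    cutSize (rook n m) X =
      ∑ i, #{j | (i, j) ∈ X} * (m - #{j | (i, j) ∈ X}) +
      ∑ j, #{i | (i, j) ∈ X} * (n - #{i | (i, j) ∈ X}) := by
  have hrow : ∀ i, #{j | (i, j) ∉ X} = m - #{j | (i, j) ∈ X} := fun i => by
    have := card_filter_add_card_filter_not (s := univ) (fun j : Fin m => (i, j) ∈ X)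
    rw [card_univ, Fintype.card_fin] at this
    omega
  have hcol : ∀ j, #{i | (i, j) ∉ X} = n - #{i | (i, j) ∈ X} := fun j => by
    have := card_filter_add_card_filter_not (s := univ) (fun i : Fin n => (i, j) ∈ X)
    rw [card_univ, Fintype.card_fin] at this
    omega
  simp only [← hrow, ← hcol, ← card_product, ← card_sigma]
  rw [← card_disjSum]
  symm
  refine card_bij (fun s _ => Sum.elim
    (fun t : (_ : Fin n) × Fin m × Fin m => ((t.1, t.2.1), (t.1, t.2.2)))
    (fun t : (_ : Fin m) × Fin n × Fin n => ((t.2.1, t.1), (t.2.2, t.1))) s) ?_ ?_ ?_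
  · rintro (⟨i, j, j'⟩ | ⟨j, i, i'⟩) h <;>
      simp only [inl_mem_disjSum, inr_mem_disjSum, mem_sigma, mem_product, mem_filter, mem_univ,
        true_and] at h <;>
      simp only [Sum.elim_inl, Sum.elim_inr, mem_filter, mem_univ, true_and]
    · exact ⟨rook_adj_of_fst_eq (fun e => h.2 (e ▸ h.1)) rfl, h⟩
    · exact ⟨rook_adj_of_snd_eq (fun e => h.2 (e ▸ h.1)) rfl, h⟩
  · rintro (⟨i, j, j'⟩ | ⟨j, i, i'⟩) h (⟨k, l, l'⟩ | ⟨l, k, k'⟩) h' e <;>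
      simp at h h' e <;> grind
  · rintro ⟨⟨i, j⟩, ⟨i', j'⟩⟩ h
    simp only [mem_filter, mem_univ, true_and, rook_adj] at h
    rcases h with ⟨⟨-, rfl⟩ | ⟨-, rfl⟩, h⟩
    · exact ⟨.inr ⟨j, i, i'⟩, by simpa using h, rfl⟩
    · exact ⟨.inl ⟨i, j, j'⟩, by simpa using h, rfl⟩

lemma card_eq_sum_row (X : Finset (Fin n × Fin m)) : #X = ∑ i, #{j | (i, j) ∈ X} := by
  rw [← card_sigma]
  exact card_bij (fun x _ => ⟨x.1, x.2⟩) (by simp) (by simp +contextual [Prod.ext_iff])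
    (fun y hy => ⟨(y.1, y.2), by simpa using hy, rfl⟩)

lemma card_eq_sum_col (X : Finset (Fin n × Fin m)) : #X = ∑ j, #{i | (i, j) ∈ X} := by
  rw [← card_sigma]
  exact card_bij (fun x _ => ⟨x.2, x.1⟩) (by simp) (by simp +contextual [Prod.ext_iff])
    (fun y hy => ⟨(y.2, y.1), by simpa using hy, rfl⟩)

lemma sum_mul_sub_ge_card_mul {ι : Type*} [Fintype ι] [DecidableEq ι] {l : ℕ} (r : ι → ℕ)
    (s : Finset ι) (hs : ∀ i ∈ s, 1 ≤ r i ∧ r i < l) :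
    #s * (l - 1) ≤ ∑ i, r i * (l - r i) := by
  refine (card_nsmul_le_sum s _ (l - 1) fun i hi => ?_).trans
    (sum_le_univ_sum_of_nonneg fun _ => Nat.zero_le _)
  obtain ⟨h₁, h₂⟩ := hs i hi
  obtain ⟨u, hu⟩ := Nat.exists_eq_add_of_le h₁
  obtain ⟨v, hv⟩ := Nat.exists_eq_add_of_lt h₂
  have e₁ : l - r i = v + 1 := by omega
  have e₂ : l - 1 = u + v + 1 := by omega
  rw [e₁, e₂, hu]
  nlinarith [Nat.zero_le (u * v)]

lemma sum_mul_sub_ge_mul_sum {ι : Type*} [Fintype ι] {l q : ℕ} (r : ι → ℕ)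
    (hq : ∀ i, r i ≤ q) : (∑ i, r i) * (l - q) ≤ ∑ i, r i * (l - r i) := by
  rw [sum_mul]
  exact sum_le_sum fun i _ => Nat.mul_le_mul_left _ (Nat.sub_le_sub_left (hq i) l)

lemma card_row_le (X : Finset (Fin n × Fin m)) (i : Fin n) :
    #{j | (i, j) ∈ X} ≤ #(X.image Prod.snd) :=
  card_le_card fun j hj => mem_image.2 ⟨(i, j), by simpa using hj, rfl⟩

lemma card_col_le (X : Finset (Fin n × Fin m)) (j : Fin m) :
    #{i | (i, j) ∈ X} ≤ #(X.image Prod.fst) :=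
  card_le_card fun i hi => mem_image.2 ⟨(i, j), by simpa using hi, rfl⟩

lemma cutSize_ge_of_empty_lines {X : Finset (Fin 6 × Fin 6)} (hX : 4 ≤ #X)
    {i₀ j₀ : Fin 6} (hi₀ : ∀ j, (i₀, j) ∉ X) (hj₀ : ∀ i, (i, j₀) ∉ X) :
    28 ≤ cutSize (rook 6 6) X := by
  rw [cutSize_rook]
  have hr := sum_mul_sub_ge_card_mul (l := 6) (fun i : Fin 6 => #{j | (i, j) ∈ X})
    (X.image Prod.fst) (by
      intro i hi
      obtain ⟨x, hx, rfl⟩ := mem_image.1 hi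
      exact ⟨card_pos.2 ⟨x.2, by simpa using hx⟩,
        card_lt_univ_of_notMem (x := j₀) (by simp [hj₀])⟩)
  have hc := sum_mul_sub_ge_card_mul (l := 6) (fun j : Fin 6 => #{i | (i, j) ∈ X})
    (X.image Prod.snd) (by
      intro j hj
      obtain ⟨x, hx, rfl⟩ := mem_image.1 hj
      exact ⟨card_pos.2 ⟨x.1, by simpa using hx⟩,
        card_lt_univ_of_notMem (x := i₀) (by simp [hi₀])⟩)
  have hr' := sum_mul_sub_ge_mul_sum (l := 6) _ (card_row_le X)
  have hc' := sum_mul_sub_ge_mul_sum (l := 6) _ (card_col_le X)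
  rw [← card_eq_sum_row] at hr'
  rw [← card_eq_sum_col] at hc'
  generalize #(X.image Prod.fst) = p at *
  generalize #(X.image Prod.snd) = q at *
  rcases Nat.lt_or_ge (p + q) 6 with h | h
  · have h₁ : 7 ≤ (6 - q) + (6 - p) := by omega
    have h₂ := Nat.mul_le_mul hX h₁
    rw [Nat.mul_add] at h₂
    omega
  · omega

lemma cutSize_ge {X : Finset (Fin 6 × Fin 6)} (hX : 4 ≤ #X) (hX' : 4 ≤ #Xᶜ) :
    28 ≤ cutSize (rook 6 6) X := by
  by_cases hrow : ∀ i, (∃ j, (i, j) ∈ X) ∧ ∃ j, (i, j) ∉ X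
  · have h := sum_mul_sub_ge_card_mul (l := 6) (fun i : Fin 6 => #{j | (i, j) ∈ X}) univ (by
      intro i _
      obtain ⟨⟨j, hj⟩, ⟨j', hj'⟩⟩ := hrow i
      exact ⟨card_pos.2 ⟨j, by simpa using hj⟩,
        card_lt_univ_of_notMem (x := j') (by simpa using hj')⟩)
    rw [cutSize_rook]
    simp only [card_univ, Fintype.card_fin] at h
    omega
  by_cases hcol : ∀ j, (∃ i, (i, j) ∈ X) ∧ ∃ i, (i, j) ∉ X
  · have h := sum_mul_sub_ge_card_mul (l := 6) (fun j : Fin 6 => #{i | (i, j) ∈ X}) univ (by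
      intro j _
      obtain ⟨⟨i, hi⟩, ⟨i', hi'⟩⟩ := hcol j
      exact ⟨card_pos.2 ⟨i, by simpa using hi⟩,
        card_lt_univ_of_notMem (x := i') (by simpa using hi')⟩)
    rw [cutSize_rook]
    simp only [card_univ, Fintype.card_fin] at h
    omega
  simp only [not_forall, not_and_or, not_exists, not_not] at hrow hcol
  obtain ⟨i₀, hi₀ | hi₀⟩ := hrow <;> obtain ⟨j₀, hj₀ | hj₀⟩ := hcol
  · exact cutSize_ge_of_empty_lines hX hi₀ hj₀
  · exact absurd (hj₀ i₀) (hi₀ j₀)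
  · exact absurd (hi₀ j₀) (hj₀ i₀)
  · rw [← cutSize_compl]
    exact cutSize_ge_of_empty_lines hX' (by simpa using hi₀) (by simpa using hj₀)

lemma cutSize_ge_of_isEggCut {k : ℕ} (hk : 4 ≤ k) {X : Finset (Fin 6 × Fin 6)}
    (hX : IsEggCut (connectedSets (rook 6 6) k) X) : 28 ≤ cutSize (rook 6 6) X := by
  obtain ⟨⟨E, hE, hEX⟩, ⟨F, hF, hFX⟩⟩ := hX
  exact cutSize_ge (hk.trans (hE.1 ▸ card_le_card hEX)) (hk.trans (hF.1 ▸ card_le_card hFX))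

lemma card_compl_add (H : Finset (Fin 6 × Fin 6)) : #H + #Hᶜ = 36 := by
  rw [card_add_card_compl]
  rfl

lemma le_scrambleOrder_connectedSets_four :
    (27 : ℕ∞) ≤ scrambleOrder (rook 6 6) (connectedSets (rook 6 6) 4) := by
  refine le_scrambleOrder (k := 27) (fun H hH => ?_)
    fun X hX => (by norm_num : 27 ≤ 28).trans (cutSize_ge_of_isEggCut le_rfl hX)
  have := mul_card_compl_le_of_isHittingSet (a := 4) (b := 3) (by norm_num) (fun s p q hs h => by
    rcases Nat.lt_or_ge (p + q) 4 with hpq | hpq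
    · obtain ⟨hp, hq⟩ : p ≤ 3 ∧ q ≤ 3 := by omega
      interval_cases p <;> interval_cases q <;> omega
    · omega) hH
  have := card_compl_add H
  omega

lemma le_scrambleOrder_connectedSets_five :
    (24 : ℕ∞) ≤ scrambleOrder (rook 6 6) (connectedSets (rook 6 6) 5) := by
  refine le_scrambleOrder (k := 24) (fun H hH => ?_)
    fun X hX => (by norm_num : 24 ≤ 28).trans (cutSize_ge_of_isEggCut (by norm_num) hX)
  have := mul_card_compl_le_of_isHittingSet (a := 1) (b := 1) (by norm_num) (fun s p q hs h => by
    rcases Nat.lt_or_ge (p + q) 4 with hpq | hpq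
    · obtain ⟨hp, hq⟩ : p ≤ 3 ∧ q ≤ 3 := by omega
      interval_cases p <;> interval_cases q <;> omega
    · omega) hH
  have := card_compl_add H
  omega

/-- The union of the three diagonal `2 × 2` blocks. -/
def diagonalBlocks : Finset (Fin 6 × Fin 6) := {x | x.1.val / 2 = x.2.val / 2}

/-- The diagonal `2 × 2` blocks, each with one corner removed. -/
def diagonalCorners : Finset (Fin 6 × Fin 6) :=
  {x | x.1.val / 2 = x.2.val / 2 ∧ (x.1.val % 2 = 0 ∨ x.2.val % 2 = 0)}

lemma diagonalCorners_subset : diagonalCorners ⊆ diagonalBlocks :=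
  monotone_filter_right _ fun _ _ h => h.1

/-- A connected set inside the diagonal blocks lies in a single block. -/
lemma subset_block {E : Finset (Fin 6 × Fin 6)}
    (hE : ((rook 6 6).induce (E : Set (Fin 6 × Fin 6))).Connected) (h : E ⊆ diagonalBlocks)
    {x : Fin 6 × Fin 6} (hx : x ∈ E) : ∀ y ∈ E, y.1.val / 2 = x.1.val / 2 := by
  intro y hy
  refine eq_of_connected_induce hE (fun z => z.1.val / 2) (fun a ha b hb hab => ?_) hy hx
  have ha' := (mem_filter.1 (h ha)).2
  have hb' := (mem_filter.1 (h hb)).2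
  rcases rook_adj.1 hab with ⟨-, e⟩ | ⟨-, e⟩
  · rw [ha', hb', e]
  · rw [e]

lemma isHittingSet_compl {S : Set (Finset (Fin 6 × Fin 6))} {T : Finset (Fin 6 × Fin 6)}
    (h : ∀ E ∈ S, ¬ E ⊆ T) : IsHittingSet S Tᶜ := by
  intro E hE
  obtain ⟨x, hx, hxT⟩ := not_subset.1 (h E hE)
  exact ⟨x, mem_inter.2 ⟨hx, mem_compl.2 hxT⟩⟩

lemma scrambleOrder_connectedSets_five_le :
    scrambleOrder (rook 6 6) (connectedSets (rook 6 6) 5) ≤ 24 := by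
  have hH : IsHittingSet (connectedSets (rook 6 6) 5) diagonalBlocksᶜ := by
    refine isHittingSet_compl fun E hE hsub => ?_
    obtain ⟨x, hx⟩ : E.Nonempty := card_pos.1 (by rw [hE.1]; norm_num)
    have hsub' : E ⊆ {y ∈ diagonalBlocks | y.1.val / 2 = x.1.val / 2} := fun y hy =>
      mem_filter.2 ⟨hsub hy, subset_block hE.2 hsub hx y hy⟩
    have hcard : ∀ i : Fin 6, #{y ∈ diagonalBlocks | y.1.val / 2 = i.val / 2} ≤ 4 := by decide
    have := (card_le_card hsub').trans (hcard x.1)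
    have := hE.1
    omega
  have hc : #diagonalBlocksᶜ = 24 := by decide
  have := scrambleOrder_le_card (G := rook 6 6) hH
  rwa [hc] at this

lemma card_neighbors_rook (x : Fin 6 × Fin 6) : #{y | (rook 6 6).Adj x y} = 10 := by
  revert x
  decide

/-- A connected set of at most three vertices has a cut of size at most `27`. -/
lemma cutSize_le_of_card_le_three {E : Finset (Fin 6 × Fin 6)}
    (hE : ((rook 6 6).induce (E : Set (Fin 6 × Fin 6))).Connected) (h : #E ≤ 3) :
    cutSize (rook 6 6) E ≤ 27 := by
  rcases Nat.lt_or_ge 1 #E with h1 | h1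
  · have := cutSize_le_card_mul (G := rook 6 6) (X := E) (d := 9) fun x hx => by
      obtain ⟨y, hy, hxy⟩ := exists_adj_mem_of_connected_induce hE h1 hx
      have : #{z | (rook 6 6).Adj x z ∧ z ∉ E} < #{z | (rook 6 6).Adj x z} := by
        refine card_lt_card (ssubset_iff_of_subset
          (monotone_filter_right _ fun _ _ h => h.1) |>.2 ⟨y, by simpa using hxy, by simp [hy]⟩)
      rw [card_neighbors_rook] at this
      omega
    omega
  · have := cutSize_le_card_mul (G := rook 6 6) (X := E) (d := 10) fun x _ =>
      (card_le_card (monotone_filter_right _ fun _ _ h => h.1)).trans_eq (card_neighbors_rook x)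
    omega

lemma scrambleOrder_rook_le {S : Set (Finset (Fin 6 × Fin 6))} (hS : IsScramble (rook 6 6) S) :
    scrambleOrder (rook 6 6) S ≤ 27 := by
  by_cases hsmall : ∃ E ∈ S, #E ≤ 3
  · obtain ⟨E, hE, hE3⟩ := hsmall
    by_cases hcut : ∃ F ∈ S, F ⊆ Eᶜ
    · refine (scrambleOrder_le_cutSize ⟨⟨E, hE, Subset.rfl⟩, hcut⟩).trans ?_
      exact_mod_cast cutSize_le_of_card_le_three (hS E hE).2 hE3
    · have hH : IsHittingSet S E := by
        have := isHittingSet_compl (S := S) (T := Eᶜ) fun F hF hsub => hcut ⟨F, hF, hsub⟩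
        rwa [compl_compl] at this
      refine (scrambleOrder_le_card hH).trans ?_
      exact_mod_cast hE3.trans (by norm_num)
  · have hH : IsHittingSet S diagonalCornersᶜ := by
      refine isHittingSet_compl fun E hE hsub => hsmall ⟨E, hE, ?_⟩
      obtain ⟨⟨x, hx⟩, hconn⟩ := hS E hE
      have hsub' : E ⊆ {y ∈ diagonalCorners | y.1.val / 2 = x.1.val / 2} := fun y hy =>
        mem_filter.2
          ⟨hsub hy, subset_block hconn (hsub.trans diagonalCorners_subset) hx y hy⟩
      have hcard : ∀ i : Fin 6, #{y ∈ diagonalCorners | y.1.val / 2 = i.val / 2} ≤ 3 := by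
        decide
      exact (card_le_card hsub').trans (hcard x.1)
    have hc : #diagonalCornersᶜ = 27 := by decide
    have := scrambleOrder_le_card (G := rook 6 6) hH
    rwa [hc] at this

end Rook

/-- The scramble number of `K_6 □ K_6` is `27`; in particular it is strictly greater
than the order of the scramble `S*_{6,6}`, which is `24`. -/
theorem sn_rook_six_six :
    scrambleNumber (rook 6 6) = (27 : ℕ∞) ∧
    scrambleOrder (rook 6 6) (SStar 6 6) = (24 : ℕ∞) ∧
    scrambleOrder (rook 6 6) (SStar 6 6) < scrambleNumber (rook 6 6) := by
  have h27 : scrambleNumber (rook 6 6) = (27 : ℕ∞) := by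
    refine le_antisymm (sSup_le ?_) (le_scrambleOrder_connectedSets_four.trans
      (le_sSup ⟨_, isScramble_connectedSets _ (by norm_num), rfl⟩))
    rintro _ ⟨S, hS, rfl⟩
    exact scrambleOrder_rook_le hS
  have h24 : scrambleOrder (rook 6 6) (SStar 6 6) = (24 : ℕ∞) :=
    le_antisymm scrambleOrder_connectedSets_five_le le_scrambleOrder_connectedSets_five
  refine ⟨h27, h24, ?_⟩
  rw [h27, h24]
  norm_num
end

section
/- Let 2 ≤ n ≤ m. The 2-gonality of the rook graph K_n □ K_m equals n·m − 1. -/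
/-- The degree of a divisor: the sum of its values. -/
def degD {V : Type*} [Fintype V] (D : V → ℤ) : ℤ := ∑ v, D v

/-- A divisor is effective if all its values are nonnegative. -/
def Effective {V : Type*} (D : V → ℤ) : Prop := ∀ v, 0 ≤ D v

/-- The number of edges from the vertex `v` to the vertex set `A`. -/
def edgesTo {V : Type*} [DecidableEq V] (G : SimpleGraph V) [DecidableRel G.Adj]
    (v : V) (A : Finset V) : ℕ := (A.filter (fun u => G.Adj v u)).card

/-- The divisor obtained from `D` by firing the vertex subset `A`: every vertex of `A`
sends one chip along each edge leaving `A`. -/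
def fire {V : Type*} [Fintype V] [DecidableEq V] (G : SimpleGraph V) [DecidableRel G.Adj]
    (D : V → ℤ) (A : Finset V) : V → ℤ :=
  fun v => if v ∈ A then D v - edgesTo G v Aᶜ else D v + edgesTo G v A

/-- Two divisors are equivalent if one is obtained from the other by a finite
sequence of subset firings. -/
def LinEquiv {V : Type*} [Fintype V] [DecidableEq V] (G : SimpleGraph V) [DecidableRel G.Adj]
    (D D' : V → ℤ) : Prop :=
  Relation.ReflTransGen (fun D₁ D₂ => ∃ A : Finset V, D₂ = fire G D₁ A) D D'

/-- A divisor `D` has rank at least `r` if for every effective divisor `E` of degree `r`,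
`D - E` is equivalent to an effective divisor. -/
def RankGE {V : Type*} [Fintype V] [DecidableEq V] (G : SimpleGraph V) [DecidableRel G.Adj]
    (D : V → ℤ) (r : ℕ) : Prop :=
  ∀ E : V → ℤ, Effective E → degD E = (r : ℤ) →
    ∃ D', LinEquiv G (D - E) D' ∧ Effective D'

/-- The `k`-gonality of a graph: the minimal degree of a divisor of rank at least `k`. -/
noncomputable def kGonality {V : Type*} [Fintype V] [DecidableEq V] (G : SimpleGraph V)
    [DecidableRel G.Adj] (k : ℕ) : ℕ :=
  sInf {d : ℕ | ∃ D : V → ℤ, RankGE G D k ∧ degD D = (d : ℤ)}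

/-- The gonality of a graph: the minimal degree of a divisor of rank at least `1`. -/
noncomputable def gonality {V : Type*} [Fintype V] [DecidableEq V] (G : SimpleGraph V)
    [DecidableRel G.Adj] : ℕ := kGonality G 1

section RookGonality

open Finset

variable {n m : ℕ}

/-- The sum of the values of `f` on the column `j`. -/
def colSum (f : Fin n × Fin m → ℤ) (j : Fin m) : ℤ := ∑ i, f (i, j)

/-- The sum of the values of `f` on the row `i`. -/
def rowSum (f : Fin n × Fin m → ℤ) (i : Fin n) : ℤ := ∑ j, f (i, j)

/-- The Laplacian of the rook graph. -/
def rookLap (f : Fin n × Fin m → ℤ) (v : Fin n × Fin m) : ℤ :=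
  (n + m) * f v - colSum f v.2 - rowSum f v.1

/-- The integer-valued indicator function of a finite set. -/
def indic (A : Finset (Fin n × Fin m)) (v : Fin n × Fin m) : ℤ := if v ∈ A then 1 else 0

lemma sum_colSum (f : Fin n × Fin m → ℤ) : ∑ j, colSum f j = ∑ v, f v := by
  rw [Fintype.sum_prod_type, Finset.sum_comm]; rfl

lemma sum_rowSum (f : Fin n × Fin m → ℤ) : ∑ i, rowSum f i = ∑ v, f v := by
  rw [Fintype.sum_prod_type]; rfl

lemma rookLap_add (f g : Fin n × Fin m → ℤ) (v : Fin n × Fin m) :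
    rookLap (f + g) v = rookLap f v + rookLap g v := by
  simp only [rookLap, colSum, rowSum, Pi.add_apply, sum_add_distrib]; ring

lemma rookLap_sub (f g : Fin n × Fin m → ℤ) (v : Fin n × Fin m) :
    rookLap (f - g) v = rookLap f v - rookLap g v := by
  simp only [rookLap, colSum, rowSum, Pi.sub_apply, sum_sub_distrib]; ring

lemma edgesTo_rook (A : Finset (Fin n × Fin m)) (v : Fin n × Fin m) :
    (edgesTo (rook n m) v A : ℤ)
      = colSum (indic A) v.2 + rowSum (indic A) v.1 - 2 * indic A v := by
  obtain ⟨i, j⟩ := v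
  have h1 : (edgesTo (rook n m) (i, j) A : ℤ)
      = ∑ u : Fin n × Fin m, ((if u.2 = j then indic A u else 0)
        + (if u.1 = i then indic A u else 0) - 2 * (if u = (i, j) then indic A u else 0)) := by
    rw [edgesTo, card_filter, Nat.cast_sum, ← univ_inter A, ← sum_ite_mem, univ_inter]
    refine sum_congr rfl fun u _ => ?_
    obtain ⟨k, l⟩ := u
    by_cases hA : (k, l) ∈ A <;> by_cases hk : k = i <;> by_cases hl : l = j <;>
      simp_all [rook, indic, SimpleGraph.boxProd_adj, eq_comm]
  rw [h1, sum_sub_distrib, sum_add_distrib, ← mul_sum]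
  congr 1
  · congr 1
    · rw [Fintype.sum_prod_type]; simp [colSum]
    · rw [Fintype.sum_prod_type_right]; simp [rowSum]
  · simp

lemma fire_rook (D : Fin n × Fin m → ℤ) (A : Finset (Fin n × Fin m)) :
    fire (rook n m) D A = D - rookLap (indic A) := by
  funext v
  have hc : ∀ u, indic Aᶜ u = 1 - indic A u := by
    intro u; by_cases h : u ∈ A <;> simp [indic, h]
  have hcol : colSum (indic Aᶜ) v.2 = n - colSum (indic A) v.2 := by
    simp [colSum, hc]
  have hrow : rowSum (indic Aᶜ) v.1 = m - rowSum (indic A) v.1 := by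
    simp [rowSum, hc]
  by_cases h : v ∈ A
  · have hv : indic A v = 1 := by simp [indic, h]
    simp only [fire, h, if_true, edgesTo_rook, hcol, hrow, hc, hv, Pi.sub_apply, rookLap]
    ring
  · have hv : indic A v = 0 := by simp [indic, h]
    simp only [fire, h, if_false, edgesTo_rook, hv, Pi.sub_apply, rookLap]
    ring

lemma LinEquiv.exists_rookLap {D D' : Fin n × Fin m → ℤ} (h : LinEquiv (rook n m) D D') :
    ∃ f, D' = D - rookLap f := by
  induction h with
  | refl => exact ⟨0, by funext v; simp [rookLap, colSum, rowSum]⟩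
  | tail _ h ih =>
    obtain ⟨f, rfl⟩ := ih
    obtain ⟨A, rfl⟩ := h
    refine ⟨f + indic A, ?_⟩
    funext v
    simp only [fire_rook, Pi.sub_apply, rookLap_add]
    ring

/-- A formulation of `RankGE (rook n m) D 2` in terms of the Laplacian. -/
def HasRankTwo (D : Fin n × Fin m → ℤ) : Prop :=
  ∀ E : Fin n × Fin m → ℤ, Effective E → degD E = 2 → ∃ f, Effective (D - E - rookLap f)

lemma RankGE.hasRankTwo {D : Fin n × Fin m → ℤ} (h : RankGE (rook n m) D 2) : HasRankTwo D := by
  intro E hE hd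
  obtain ⟨D', h1, h2⟩ := h E hE (by simpa using hd)
  obtain ⟨f, rfl⟩ := h1.exists_rookLap
  exact ⟨f, h2⟩

lemma HasRankTwo.sub_rookLap {D : Fin n × Fin m → ℤ} (h : HasRankTwo D)
    (g : Fin n × Fin m → ℤ) : HasRankTwo (D - rookLap g) := by
  intro E hE hd
  obtain ⟨f, hf⟩ := h E hE hd
  refine ⟨f - g, fun v => ?_⟩
  have := hf v
  simp only [Pi.sub_apply, rookLap_sub] at *
  linarith

lemma sum_rookLap (f : Fin n × Fin m → ℤ) : ∑ v, rookLap f v = 0 := by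
  have h1 : ∑ v : Fin n × Fin m, colSum f v.2 = n * ∑ v, f v := by
    rw [Fintype.sum_prod_type]; simp [sum_colSum]
  have h2 : ∑ v : Fin n × Fin m, rowSum f v.1 = m * ∑ v, f v := by
    rw [Fintype.sum_prod_type_right]; simp [sum_rowSum]
  simp only [rookLap, sum_sub_distrib, ← mul_sum, h1, h2]
  ring

lemma colSum_rookLap (f : Fin n × Fin m → ℤ) (j : Fin m) :
    colSum (rookLap f) j = m * colSum f j - ∑ v, f v := by
  rw [← sum_rowSum]
  simp only [colSum, rookLap, sum_sub_distrib, ← mul_sum, sum_const, card_univ, Fintype.card_fin,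
    nsmul_eq_mul]
  ring

/-- A nonempty set of vertices, with indicator function `x`, each of which holds enough chips
in `D` for the set to be fired. -/
structure IsLegal (D x : Fin n × Fin m → ℤ) : Prop where
  zero_or_one : ∀ v, x v = 0 ∨ x v = 1
  exists_eq_one : ∃ v, x v = 1
  le : ∀ v, x v = 1 → rookLap x v ≤ D v

namespace IsLegal

variable {D x : Fin n × Fin m → ℤ}

lemma nonneg (h : IsLegal D x) (v) : 0 ≤ x v := by
  rcases h.zero_or_one v with h | h <;> omega

lemma le_one (h : IsLegal D x) (v) : x v ≤ 1 := by
  rcases h.zero_or_one v with h | h <;> omega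

lemma colSum_nonneg (h : IsLegal D x) (j) : 0 ≤ colSum x j := sum_nonneg fun _ _ => h.nonneg _

lemma rowSum_nonneg (h : IsLegal D x) (i) : 0 ≤ rowSum x i := sum_nonneg fun _ _ => h.nonneg _

lemma colSum_le (h : IsLegal D x) (j) : colSum x j ≤ n := by
  simpa [colSum] using sum_le_sum (s := univ) fun i _ => h.le_one (i, j)

lemma rowSum_le (h : IsLegal D x) (i) : rowSum x i ≤ m := by
  simpa [rowSum] using sum_le_sum (s := univ) fun j _ => h.le_one (i, j)

lemma le_colSum (h : IsLegal D x) (v : Fin n × Fin m) : x v ≤ colSum x v.2 :=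
  single_le_sum (f := fun i => x (i, v.2)) (fun _ _ => h.nonneg _) (mem_univ v.1)

lemma le_rowSum (h : IsLegal D x) (v : Fin n × Fin m) : x v ≤ rowSum x v.1 :=
  single_le_sum (f := fun j => x (v.1, j)) (fun _ _ => h.nonneg _) (mem_univ v.2)

lemma eq_zero_of_colSum (h : IsLegal D x) {v : Fin n × Fin m} (hv : colSum x v.2 = 0) :
    x v = 0 := le_antisymm (hv ▸ h.le_colSum v) (h.nonneg v)

lemma eq_one_of_colSum (h : IsLegal D x) {v : Fin n × Fin m} (hv : colSum x v.2 = n) :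
    x v = 1 := by
  have h1 := single_le_sum (f := fun i => 1 - x (i, v.2)) (s := univ)
    (fun i _ => sub_nonneg.2 (h.le_one (i, v.2))) (mem_univ v.1)
  have h2 : ∑ i, (1 - x (i, v.2)) = n - colSum x v.2 := by simp [colSum]
  have h3 := h.le_one v
  rw [h2, hv] at h1
  simp only [Prod.mk.eta] at h1
  omega

lemma mul_le (h : IsLegal D x) (v : Fin n × Fin m) :
    x v * (n + m - colSum x v.2 - rowSum x v.1) ≤ x v * D v := by
  rcases h.zero_or_one v with hv | hv
  · simp [hv]
  · have := h.le v hv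
    simp only [rookLap, hv] at *
    linarith

lemma sum_mul_le (h : IsLegal D x) (hD : Effective D) :
    ∑ v, x v * D v ≤ ∑ v, D v := sum_le_sum fun v _ => by
  nlinarith [hD v, h.le_one v]

lemma col_bound (h : IsLegal D x) (j : Fin m) :
    colSum x j * (n - colSum x j) + ∑ i, x (i, j) * (m - rowSum x i)
      ≤ ∑ i, x (i, j) * D (i, j) := by
  have h1 := sum_le_sum (s := univ) fun i _ => h.mul_le (i, j)
  refine le_trans (le_of_eq ?_) h1
  conv_lhs => enter [1, 1]; rw [colSum]
  rw [sum_mul, ← sum_add_distrib]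
  exact sum_congr rfl fun i _ => by ring

lemma col_bound' (h : IsLegal D x) (j : Fin m) {t : ℤ} (ht : ∀ i, rowSum x i ≤ m - t) :
    colSum x j * (n - colSum x j + t) ≤ ∑ i, x (i, j) * D (i, j) := by
  refine le_trans ?_ (h.col_bound j)
  have : colSum x j * t ≤ ∑ i, x (i, j) * (m - rowSum x i) := by
    rw [colSum, sum_mul]
    exact sum_le_sum fun i _ => mul_le_mul_of_nonneg_left (by linarith [ht i]) (h.nonneg _)
  linarith

lemma sum_col_le (h : IsLegal D x) (hD : Effective D) (j : Fin m) :
    ∑ i, x (i, j) * D (i, j) ≤ colSum D j := sum_le_sum fun i _ => by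
  nlinarith [hD (i, j), h.le_one (i, j)]

lemma total_bound (h : IsLegal D x) :
    ∑ j, colSum x j * (n - colSum x j) + ∑ i, rowSum x i * (m - rowSum x i)
      ≤ ∑ v, x v * D v := by
  have h1 := sum_le_sum (s := univ) fun j _ => h.col_bound j
  rw [sum_add_distrib] at h1
  rw [Fintype.sum_prod_type_right]
  refine le_trans (le_of_eq ?_) h1
  congr 1
  rw [sum_comm]
  refine sum_congr rfl fun i _ => ?_
  rw [← sum_mul]
  rfl

lemma effective_fire (h : IsLegal D x) (hD : Effective D) : Effective (D - rookLap x) := by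
  intro v
  rcases h.zero_or_one v with hv | hv
  · have := hD v
    have := h.colSum_nonneg v.2
    have := h.rowSum_nonneg v.1
    simp only [Pi.sub_apply, rookLap, hv]
    linarith
  · have := h.le v hv
    simp only [Pi.sub_apply]
    linarith

lemma mono {D' : Fin n × Fin m → ℤ} (h : IsLegal D x) (hD : ∀ v, D v ≤ D' v) : IsLegal D' x :=
  ⟨h.zero_or_one, h.exists_eq_one, fun v hv => (h.le v hv).trans (hD v)⟩

lemma rowSum_le_of_colSum_eq_zero (h : IsLegal D x) (i : Fin n) :
    rowSum x i ≤ m - ∑ j, (if colSum x j = 0 then 1 else 0) := by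
  have : rowSum x i ≤ ∑ j, (1 - if colSum x j = 0 then 1 else 0) := by
    refine sum_le_sum fun j _ => ?_
    split_ifs with hj
    · simp [h.eq_zero_of_colSum (v := (i, j)) hj]
    · simpa using h.le_one (i, j)
  simpa using this

lemma colSum_eq_zero_of_lt (h : IsLegal D x) {q : Fin n × Fin m} (hq : x q = 0)
    (hs : ∑ i, x (i, q.2) * D (i, q.2) < (n : ℤ) - 1) : colSum x q.2 = 0 := by
  have h1 := h.col_bound' q.2 (t := 0) (by simpa using h.rowSum_le)
  have h2 := h.colSum_nonneg q.2
  have h3 : colSum x q.2 < n := by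
    refine lt_of_le_of_ne (h.colSum_le _) fun h4 => ?_
    have := h.eq_one_of_colSum h4
    omega
  by_contra h4
  have h5 : 1 ≤ colSum x q.2 := by omega
  nlinarith

end IsLegal

/-- If `D - E` is in debt at `q`, then the vertices where a firing script making `D - E` effective
is maximal form a legal set avoiding `q`. -/
lemma HasRankTwo.exists_isLegal {D : Fin n × Fin m → ℤ} (h : HasRankTwo D)
    {E : Fin n × Fin m → ℤ} (hE : Effective E) (hd : degD E = 2) {q : Fin n × Fin m}
    (hq : D q < E q) : ∃ x, IsLegal (D - E) x ∧ x q = 0 := by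
  obtain ⟨f, hf⟩ := h E hE hd
  obtain ⟨w, -, hw⟩ := exists_max_image univ f ⟨q, mem_univ q⟩
  have hw : ∀ v, f v ≤ f w := fun v => hw v (mem_univ v)
  let x : Fin n × Fin m → ℤ := fun v => if f v = f w then 1 else 0
  have hx : ∀ v, x v = if f v = f w then 1 else 0 := fun _ => rfl
  have key : ∀ v, x v = 1 → rookLap x v ≤ rookLap f v := by
    intro v hv
    have hfv : f v = f w := by
      by_contra hne
      simp [hx, hne] at hv
    have h1 : ∀ u, 1 - x u ≤ f v - f u := by
      intro u
      have := hw u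
      rw [hx]
      split_ifs <;> omega
    have h2 := sum_le_sum (s := univ) fun i _ => h1 (i, v.2)
    have h3 := sum_le_sum (s := univ) fun j _ => h1 (v.1, j)
    simp only [sum_sub_distrib, sum_const, card_univ, Fintype.card_fin, nsmul_eq_mul] at h2 h3
    simp only [rookLap, hv, colSum, rowSum]
    linarith
  have hle : ∀ v, x v = 1 → rookLap x v ≤ (D - E) v := fun v hv => by
    have := hf v
    have := key v hv
    simp only [Pi.sub_apply] at *
    linarith
  have hL : IsLegal (D - E) x :=
    ⟨fun v => by rw [hx]; split_ifs <;> simp, ⟨w, by simp [hx]⟩, hle⟩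
  refine ⟨x, hL, (hL.zero_or_one q).resolve_right fun h1 => ?_⟩
  have h2 := hle q h1
  have h3 := hL.colSum_le q.2
  have h4 := hL.rowSum_le q.1
  simp only [rookLap, h1, Pi.sub_apply] at h2
  linarith

lemma effective_single_add_single (u v : Fin n × Fin m) :
    Effective (Pi.single u 1 + Pi.single v 1 : Fin n × Fin m → ℤ) := by
  intro w
  simp only [Pi.add_apply, Pi.single_apply]
  split_ifs <;> simp

lemma degD_single_add_single (u v : Fin n × Fin m) :
    degD (Pi.single u 1 + Pi.single v 1 : Fin n × Fin m → ℤ) = 2 := by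
  simp [degD, sum_add_distrib]

lemma exists_eq_zero_of_colSum_lt {D : Fin n × Fin m → ℤ} (hD : Effective D) {j : Fin m}
    (h : colSum D j < n) : ∃ i, D (i, j) = 0 := by
  by_contra! hne
  have : ∑ i : Fin n, (1 : ℤ) ≤ colSum D j := sum_le_sum fun i _ => by
    have := hD (i, j)
    have := hne i
    omega
  simp at this
  omega

/-- A column with few chips is avoided by some legal set. -/
lemma HasRankTwo.exists_isLegal_of_colSum_lt (hn : 2 ≤ n) {D : Fin n × Fin m → ℤ}
    (h : HasRankTwo D) (hD : Effective D) {j : Fin m} (hj : colSum D j < n) :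
    ∃ x, IsLegal D x ∧ colSum x j = 0 := by
  obtain ⟨i, hi⟩ := exists_eq_zero_of_colSum_lt hD hj
  obtain ⟨p, -, hp⟩ := exists_max_image univ (fun i => D (i, j)) ⟨i, mem_univ i⟩
  have hp : ∀ i, D (i, j) ≤ D (p, j) := fun i => hp i (mem_univ i)
  let E : Fin n × Fin m → ℤ := Pi.single (i, j) 1 + Pi.single (p, j) 1
  have hE : Effective E := effective_single_add_single _ _
  have hEi : 1 ≤ E (i, j) := by
    simp only [E, Pi.add_apply, Pi.single_apply, if_true]
    split_ifs <;> omega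
  have hEp : 1 ≤ E (p, j) := by
    simp only [E, Pi.add_apply, Pi.single_apply, if_true]
    split_ifs <;> omega
  obtain ⟨x, hx, hq⟩ := h.exists_isLegal hE (degD_single_add_single _ _) (q := (i, j)) (by omega)
  refine ⟨x, hx.mono fun v => by simpa using hE v, hx.colSum_eq_zero_of_lt hq ?_⟩
  have hb : ∀ k, x (k, j) * (D - E) (k, j) ≤ D (k, j) - if k = p ∧ 1 ≤ D (p, j) then 1 else 0 := by
    intro k
    have h1 := hD (k, j)
    have h2 := hE (k, j)
    rcases hx.zero_or_one (k, j) with hk | hk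
    · rw [hk]
      split_ifs with hkp
      · rw [hkp.1]; omega
      · omega
    · rw [hk, Pi.sub_apply]
      split_ifs with hkp
      · rw [hkp.1]; omega
      · omega
  have hs := sum_le_sum (s := univ) fun k _ => hb k
  refine lt_of_le_of_lt hs ?_
  by_cases h1 : 1 ≤ D (p, j)
  · simp only [h1, and_true, sum_sub_distrib, sum_ite_eq', mem_univ, if_true]
    change colSum D j - 1 < _
    omega
  · have h0 : ∀ k, D (k, j) = 0 := fun k => by
      have := hD (k, j)
      have := hp k
      omega
    simp [h0]
    omega

/-- Small divisors positive off a column do not have rank two. -/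
lemma HasRankTwo.not_of_pos_off_column (hn : 2 ≤ n) (hnm : n ≤ m) {D : Fin n × Fin m → ℤ}
    (h : HasRankTwo D) (hD : Effective D) (hdeg : ∑ v, D v ≤ (n : ℤ) * m - 2) {C : Fin m}
    (hC : ∀ v : Fin n × Fin m, v.2 ≠ C → 1 ≤ D v) : False := by
  have hcol : ∀ j ≠ C, n ≤ colSum D j := by
    intro j hj
    have : ∑ i : Fin n, (1 : ℤ) ≤ colSum D j := sum_le_sum fun i _ => hC (i, j) hj
    simpa using this
  have hsplit : colSum D C + ∑ j ∈ univ.erase C, colSum D j = ∑ v, D v := by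
    rw [add_sum_erase _ _ (mem_univ C), sum_colSum]
  have hcard : ((univ.erase C).card : ℤ) = m - 1 := by
    rw [card_erase_of_mem (mem_univ C), card_univ, Fintype.card_fin]
    have := C.pos
    omega
  have hCsmall : colSum D C ≤ n - 2 := by
    have := sum_le_sum (s := univ.erase C) (f := fun _ => (n : ℤ)) (g := colSum D)
      fun j hj => hcol j (ne_of_mem_erase hj)
    rw [sum_const, nsmul_eq_mul, hcard] at this
    linarith
  have hCpos : 0 ≤ colSum D C := sum_nonneg fun i _ => hD _
  obtain ⟨C', hC', hC'n⟩ : ∃ j, j ≠ C ∧ colSum D j = n := by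
    by_contra! hne
    have := sum_le_sum (s := univ.erase C) (f := fun _ => (n : ℤ) + 1) (g := colSum D)
      fun j hj => by
        have h1 := ne_of_mem_erase hj
        have := hcol j h1
        have := hne j h1
        omega
    rw [sum_const, nsmul_eq_mul, hcard] at this
    have : (n : ℤ) ≤ m := by exact_mod_cast hnm
    nlinarith
  have hone : ∀ i, D (i, C') = 1 := by
    have h1 : ∑ i, (D (i, C') - 1) = 0 := by
      rw [sum_sub_distrib]
      change colSum D C' - _ = 0
      simp [hC'n]
    intro i
    have := (sum_eq_zero_iff_of_nonneg fun i _ => sub_nonneg.2 (hC (i, C') hC')).1 h1 i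
      (mem_univ i)
    omega
  obtain ⟨i, hi⟩ := exists_eq_zero_of_colSum_lt hD (j := C) (by omega)
  let E : Fin n × Fin m → ℤ := Pi.single (i, C) 1 + Pi.single (i, C') 1
  have hE : Effective E := effective_single_add_single _ _
  have hE1 : E (i, C) = 1 := by simp [E, hC'.symm]
  have hE2 : E (i, C') = 1 := by simp [E, hC']
  obtain ⟨x, hx', hq⟩ := h.exists_isLegal hE (degD_single_add_single _ _) (q := (i, C)) (by omega)
  have hx : IsLegal D x := hx'.mono fun v => by simpa using hE v
  have hxC : colSum x C = 0 := hx.colSum_eq_zero_of_lt hq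
    (lt_of_le_of_lt (hx.sum_col_le hD C) (by omega))
  have hrow1 : ∀ i, rowSum x i ≤ m - 1 := by
    intro i
    have h1 := hx.rowSum_le_of_colSum_eq_zero i
    have h2 := single_le_sum (f := fun j => if colSum x j = 0 then (1 : ℤ) else 0) (s := univ)
      (fun j _ => by positivity) (mem_univ C)
    simp only [hxC, if_true] at h2
    omega
  have hx2 : x (i, C') = 0 := by
    refine (hx.zero_or_one _).resolve_right fun h1 => ?_
    have h2 := hx'.le _ h1
    have h3 := hx.colSum_le C'
    have h4 := hrow1 i
    simp only [rookLap, h1, Pi.sub_apply, hE2, hone] at h2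
    omega
  have hxC' : colSum x C' = 0 := by
    have hlt : colSum x C' < n := by
      refine lt_of_le_of_ne (hx.colSum_le _) fun h4 => ?_
      have := hx.eq_one_of_colSum (v := (i, C')) h4
      omega
    refine sum_eq_zero fun k _ => (hx.zero_or_one _).resolve_right fun h1 => ?_
    have h2 := hx.le _ h1
    have h4 := hrow1 k
    simp only [rookLap, h1, hone] at h2
    omega
  have hrow2 : ∀ i, rowSum x i ≤ m - 2 := by
    intro i
    have h1 := hx.rowSum_le_of_colSum_eq_zero i
    have h2 := sum_le_sum_of_subset_of_nonneg (f := fun j => if colSum x j = 0 then (1 : ℤ) else 0)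
      (subset_univ {C, C'}) (fun j _ _ => by positivity)
    rw [sum_pair hC'.symm] at h2
    simp only [hxC, hxC', if_true] at h2
    omega
  obtain ⟨v, hv⟩ := hx.exists_eq_one
  have hpos : ∀ u, 0 ≤ x u * (D u - 2) := by
    intro u
    rcases hx.zero_or_one u with hu | hu
    · simp [hu]
    · have h1 := hx.le u hu
      have h2 := hx.colSum_le u.2
      have h3 := hrow2 u.1
      simp only [rookLap, hu] at h1 ⊢
      omega
  have hsum : ∑ u, x u * (D u - 1) ≤ n - 2 := by
    have h1 : ∀ u : Fin n × Fin m, x u * (D u - 1) ≤ D u - if u.2 = C then 0 else 1 := by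
      intro u
      have h0 := hD u
      split_ifs with hu
      · rw [hx.eq_zero_of_colSum (by rw [hu, hxC])]; omega
      · have := hC u hu
        nlinarith [hx.le_one u]
    have h2 := sum_le_sum (s := univ) fun u _ => h1 u
    have h3 : ∑ u : Fin n × Fin m, (if u.2 = C then (0 : ℤ) else 1) = n * (m - 1) := by
      rw [Fintype.sum_prod_type]
      have : ∀ j : Fin m, (if j = C then (0 : ℤ) else 1) = 1 - if j = C then 1 else 0 := by
        intro j; split_ifs <;> simp
      simp [this, mul_sub]
    rw [sum_sub_distrib, h3] at h2
    linarith
  have hvle : x v * (D v - 2) ≤ ∑ u, x u * (D u - 2) :=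
    single_le_sum (fun u _ => hpos u) (mem_univ v)
  have hsum' : ∑ u, x u * (D u - 1) = ∑ u, x u * (D u - 2) + ∑ u, x u := by
    rw [← sum_add_distrib]
    exact sum_congr rfl fun u _ => by ring
  have hcross : colSum x v.2 + rowSum x v.1 - 1 ≤ ∑ u, x u := by
    have h1 : colSum x v.2 - 1 ≤ ∑ k ∈ univ.erase v.1, rowSum x k := by
      have h2 : x v + ∑ k ∈ univ.erase v.1, x (k, v.2) = colSum x v.2 :=
        add_sum_erase _ (fun k => x (k, v.2)) (mem_univ v.1)
      have h3 : ∑ k ∈ univ.erase v.1, x (k, v.2) ≤ ∑ k ∈ univ.erase v.1, rowSum x k :=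
        sum_le_sum fun k _ => hx.le_rowSum (k, v.2)
      omega
    rw [← sum_rowSum, ← add_sum_erase _ _ (mem_univ v.1)]
    omega
  have hvl := hx.le v hv
  simp only [rookLap, hv] at hvl hvle
  omega

/-- A small divisor of rank two has no legal set which contains a column and avoids another. -/
lemma HasRankTwo.not_of_full_column (hn : 2 ≤ n) (hnm : n ≤ m) {D x : Fin n × Fin m → ℤ}
    (h : HasRankTwo D) (hD : Effective D) (hdeg : ∑ v, D v ≤ (n : ℤ) * m - 2) (hx : IsLegal D x)
    {C F : Fin m} (hC : colSum x C = 0) (hF : colSum x F = n) : False := by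
  have htot := hx.total_bound.trans ((hx.sum_mul_le hD).trans hdeg)
  have hx0 : ∀ i, x (i, C) = 0 := fun i => hx.eq_zero_of_colSum (v := (i, C)) hC
  have hx1 : ∀ i, x (i, F) = 1 := fun i => hx.eq_one_of_colSum (v := (i, F)) hF
  have hlow : ∀ i, 1 ≤ rowSum x i := fun i => by simpa [hx1] using hx.le_rowSum (i, F)
  have hcomp : ∀ i j, 1 - x (i, j) ≤ m - rowSum x i := by
    intro i j
    have := single_le_sum (f := fun j => 1 - x (i, j)) (s := univ)
      (fun j _ => sub_nonneg.2 (hx.le_one (i, j))) (mem_univ j)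
    simpa [rowSum] using this
  have hhigh : ∀ i, rowSum x i ≤ m - 1 := fun i => by
    have := hcomp i C
    rw [hx0] at this
    omega
  have hkn : ∀ j, 0 ≤ colSum x j * (n - colSum x j) := fun j =>
    mul_nonneg (hx.colSum_nonneg j) (sub_nonneg.2 (hx.colSum_le j))
  have hk : ∀ j, colSum x j = 0 ∨ colSum x j = n := by
    intro j
    by_contra! hne
    have h1 := single_le_sum (f := fun j => colSum x j * (n - colSum x j)) (s := univ)
      (fun j _ => hkn j) (mem_univ j)
    have h2 : ∑ i : Fin n, ((m : ℤ) - 1) ≤ ∑ i, rowSum x i * (m - rowSum x i) :=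
      sum_le_sum fun i _ => by nlinarith [hlow i, hhigh i]
    have h3 : 1 ≤ colSum x j := by have := hx.colSum_nonneg j; omega
    have h4 : colSum x j ≤ n - 1 := by have := hx.colSum_le j; omega
    simp only [sum_const, card_univ, Fintype.card_fin, nsmul_eq_mul] at h2
    nlinarith
  have hconst : ∀ i i', rowSum x i = rowSum x i' := by
    intro i i'
    refine sum_congr rfl fun j _ => ?_
    rcases hk j with hj | hj
    · rw [hx.eq_zero_of_colSum (v := (i, j)) hj, hx.eq_zero_of_colSum (v := (i', j)) hj]
    · rw [hx.eq_one_of_colSum (v := (i, j)) hj, hx.eq_one_of_colSum (v := (i', j)) hj]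
  let i₀ : Fin n := ⟨0, by omega⟩
  have hrow : rowSum x i₀ * (m - rowSum x i₀) < m := by
    have h1 : ∑ i, rowSum x i * (m - rowSum x i) = n * (rowSum x i₀ * (m - rowSum x i₀)) := by
      rw [sum_congr rfl fun i _ => by rw [hconst i i₀]]
      simp
    have h2 := sum_nonneg (s := univ) fun j _ => hkn j
    rw [h1] at htot
    by_contra! h3
    have : (0 : ℤ) ≤ n := by positivity
    nlinarith
  have hcase : rowSum x i₀ = 1 ∨ rowSum x i₀ = m - 1 := by
    have h1 := hlow i₀
    have h2 := hhigh i₀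
    by_contra! hne
    have h3 : 2 ≤ rowSum x i₀ := by omega
    have h4 : rowSum x i₀ ≤ m - 2 := by omega
    nlinarith
  rcases hcase with ha | ha
  · refine (h.sub_rookLap x).not_of_pos_off_column hn hnm (hx.effective_fire hD) (C := F) ?_ ?_
    · simpa [sum_sub_distrib, sum_rookLap] using hdeg
    · intro v hv
      have h0 : x v = 0 := by
        have h1 := sum_le_sum_of_subset_of_nonneg (f := fun j => x (v.1, j))
          (subset_univ {v.2, F}) (fun j _ _ => hx.nonneg _)
        rw [sum_pair hv, hx1] at h1
        have h2 : ∑ j, x (v.1, j) = 1 := by rw [← ha, hconst i₀ v.1]; rfl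
        have h3 := hx.nonneg v
        simp only [Prod.mk.eta] at h1
        omega
      have h1 := hD v
      have h2 := hx.colSum_nonneg v.2
      have h3 := hlow v.1
      simp only [Pi.sub_apply, rookLap, h0]
      linarith
  · refine h.not_of_pos_off_column hn hnm hD hdeg (C := C) fun v hv => ?_
    have hone : x v = 1 := by
      have h1 := sum_le_sum_of_subset_of_nonneg (f := fun j => 1 - x (v.1, j))
        (subset_univ {v.2, C}) (fun j _ _ => sub_nonneg.2 (hx.le_one _))
      rw [sum_pair hv, hx0] at h1
      have h2 : ∑ j, (1 - x (v.1, j)) = m - rowSum x v.1 := by simp [rowSum]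
      rw [h2, hconst v.1 i₀, ha] at h1
      have h3 := hx.le_one v
      simp only [Prod.mk.eta] at h1
      omega
    have h1 := hx.le v hone
    have h2 := hx.colSum_le v.2
    have h3 := hhigh v.1
    simp only [rookLap, hone] at h1
    omega

/-- The weighted deficiency of a column of size `n` with `c` chips. -/
def deficiency (n m : ℕ) (c : ℤ) : ℤ := m * max 0 (n - 1 - c) + max 0 (n - c)

lemma deficiency_nonneg (c : ℤ) : 0 ≤ deficiency n m c := by
  unfold deficiency; positivity

lemma deficiency_anti {c c' : ℤ} (h : c ≤ c') : deficiency n m c' ≤ deficiency n m c := by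
  unfold deficiency; gcongr

lemma deficiency_le_one {c : ℤ} (h : (n : ℤ) - 1 ≤ c) : deficiency n m c ≤ 1 := by
  unfold deficiency
  rw [max_eq_left (by omega)]
  omega

lemma deficiency_eq_zero {c : ℤ} (h : (n : ℤ) ≤ c) : deficiency n m c = 0 := by
  unfold deficiency
  rw [max_eq_left (by omega), max_eq_left (by omega)]
  simp

lemma sub_le_deficiency (c : ℤ) : (n : ℤ) - c ≤ deficiency n m c := by
  unfold deficiency
  have : (0 : ℤ) ≤ m * max 0 (n - 1 - c) := by positivity
  omega

lemma deficiency_drop {c c' : ℤ} (hc : c ≤ n - 2) (h : c + 1 ≤ c') :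
    deficiency n m c' + (m + 1) ≤ deficiency n m c := by
  refine le_trans (add_le_add_left (deficiency_anti h) _) (le_of_eq ?_)
  unfold deficiency
  rw [max_eq_right (by omega), max_eq_right (by omega), max_eq_right (by omega),
    max_eq_right (by omega)]
  ring

/-- Firing a legal set that contains no column leaves at least `n - 1` chips on each column
it meets. -/
lemma IsLegal.le_colSum_fire {D x : Fin n × Fin m → ℤ} (hx : IsLegal D x) (hD : Effective D)
    {j : Fin m} (h0 : colSum x j ≠ 0) (hn : colSum x j ≠ n) :
    (n : ℤ) - 1 ≤ colSum (D - rookLap x) j := by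
  have h1 := (hx.col_bound j).trans (hx.sum_col_le hD j)
  have h2 : ∑ i, x (i, j) * (m - rowSum x i) = m * colSum x j - ∑ i, x (i, j) * rowSum x i := by
    rw [colSum, mul_sum, ← sum_sub_distrib]
    exact sum_congr rfl fun i _ => by ring
  have h3 : ∑ i, x (i, j) * rowSum x i ≤ ∑ v, x v := by
    rw [← sum_rowSum]
    exact sum_le_sum fun i _ => by nlinarith [hx.le_one (i, j), hx.rowSum_nonneg i]
  have h4 : colSum (D - rookLap x) j = colSum D j - colSum (rookLap x) j := by
    simp [colSum, sum_sub_distrib]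
  have h5 : 1 ≤ colSum x j := by have := hx.colSum_nonneg j; omega
  have h6 : colSum x j ≤ n - 1 := by have := hx.colSum_le j; omega
  rw [h4, colSum_rookLap]
  nlinarith

/-- A small divisor of rank two can be replaced by one with smaller total deficiency. -/
lemma HasRankTwo.exists_deficiency_lt (hn : 2 ≤ n) (hnm : n ≤ m) {D : Fin n × Fin m → ℤ}
    (h : HasRankTwo D) (hD : Effective D) (hdeg : ∑ v, D v ≤ (n : ℤ) * m - 2) :
    ∃ x, IsLegal D x ∧
      ∑ j, deficiency n m (colSum (D - rookLap x) j) < ∑ j, deficiency n m (colSum D j) := by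
  have hdef : 2 ≤ ∑ j, (n - colSum D j) := by
    rw [sum_sub_distrib, sum_colSum]
    simp
    linarith
  have hsub : ∀ x j, colSum (D - rookLap x) j = colSum D j - m * colSum x j + ∑ v, x v := by
    intro x j
    have : colSum (D - rookLap x) j = colSum D j - colSum (rookLap x) j := by
      simp [colSum, sum_sub_distrib]
    rw [this, colSum_rookLap]
    ring
  have hsize : ∀ x, IsLegal D x → 1 ≤ ∑ v, x v := by
    intro x hx
    obtain ⟨v, hv⟩ := hx.exists_eq_one
    exact hv ▸ single_le_sum (fun u _ => hx.nonneg u) (mem_univ v)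
  have hunmet : ∀ x j, IsLegal D x → colSum x j = 0 →
      colSum D j + 1 ≤ colSum (D - rookLap x) j := by
    intro x j hx hj
    have := hsize x hx
    rw [hsub, hj]
    linarith
  have hmet : ∀ x C j, IsLegal D x → colSum x C = 0 → colSum x j ≠ 0 →
      (n : ℤ) - 1 ≤ colSum (D - rookLap x) j := fun x C j hx hC hj =>
    hx.le_colSum_fire hD hj fun hF => h.not_of_full_column hn hnm hD hdeg hx hC hF
  by_cases hA : ∃ C, colSum D C ≤ n - 2
  · obtain ⟨C, hC⟩ := hA
    obtain ⟨x, hx, hxC⟩ := h.exists_isLegal_of_colSum_lt hn hD (j := C) (by omega)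
    refine ⟨x, hx, ?_⟩
    have hterm : ∀ j, deficiency n m (colSum (D - rookLap x) j)
        ≤ deficiency n m (colSum D j) + (1 - if j = C then (m : ℤ) + 2 else 0) := by
      intro j
      split_ifs with hj
      · have := deficiency_drop (m := m) hC (hunmet x C hx hxC)
        rw [hj]
        linarith
      · by_cases hxj : colSum x j = 0
        · have := deficiency_anti (n := n) (m := m)
            (le_trans (by omega : colSum D j ≤ colSum D j + 1) (hunmet x j hx hxj))
          linarith
        · have := deficiency_le_one (m := m) (hmet x C j hx hxC hxj)
          have := deficiency_nonneg (n := n) (m := m) (colSum D j)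
          linarith
    have hs := sum_le_sum (s := univ) fun j _ => hterm j
    simp only [sum_add_distrib, sum_sub_distrib, sum_ite_eq', mem_univ, if_true, sum_const,
      card_univ, Fintype.card_fin, nsmul_eq_mul] at hs
    linarith
  · push Not at hA
    obtain ⟨C, hC⟩ : ∃ C, colSum D C < n := by
      by_contra! hge
      have := sum_nonpos (s := univ) fun j _ => sub_nonpos.2 (hge j)
      omega
    obtain ⟨x, hx, hxC⟩ := h.exists_isLegal_of_colSum_lt hn hD hC
    refine ⟨x, hx, ?_⟩
    let u : Fin m → ℤ := fun j => if colSum x j = 0 then 1 else 0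
    have hu1 : ∀ j, colSum x j = 0 → u j = 1 := fun j hj => if_pos hj
    have hu0 : ∀ j, colSum x j ≠ 0 → u j = 0 := fun j hj => if_neg hj
    have hu : ∀ j, 0 ≤ u j := fun j => by
      by_cases hj : colSum x j = 0
      · rw [hu1 j hj]; omega
      · rw [hu0 j hj]
    have hrow : ∀ i, rowSum x i ≤ m - ∑ j, u j := hx.rowSum_le_of_colSum_eq_zero
    have ht1 : 1 ≤ ∑ j, u j := hu1 C hxC ▸ single_le_sum (fun j _ => hu j) (mem_univ C)
    have hfull : ∀ j, colSum x j ≠ n := fun j hF =>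
      h.not_of_full_column hn hnm hD hdeg hx hxC hF
    have hbig : ∀ j, colSum x j ≠ 0 → n - 1 + ∑ j, u j ≤ colSum D j := by
      intro j hj
      have h1 := (hx.col_bound' j hrow).trans (hx.sum_col_le hD j)
      have h2 : 1 ≤ colSum x j := by have := hx.colSum_nonneg j; omega
      have h3 : colSum x j ≤ n - 1 := by have := hx.colSum_le j; have := hfull j; omega
      nlinarith
    have ht2 : 2 ≤ ∑ j, u j := by
      refine hdef.trans (sum_le_sum fun j _ => ?_)
      by_cases hj : colSum x j = 0
      · rw [hu1 j hj]
        have := hA j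
        omega
      · rw [hu0 j hj]
        have := hbig j hj
        omega
    have hnew : ∑ j, deficiency n m (colSum (D - rookLap x) j) ≤ ∑ j, (1 - u j) := by
      refine sum_le_sum fun j _ => ?_
      by_cases hj : colSum x j = 0
      · have h1 := hunmet x j hx hj
        have h2 := hA j
        rw [hu1 j hj, deficiency_eq_zero (by omega)]
        omega
      · rw [hu0 j hj]
        exact deficiency_le_one (hmet x C j hx hxC hj)
    have hold : ∑ j, ((n - colSum D j) + (1 - u j)) ≤ ∑ j, deficiency n m (colSum D j) := by
      refine sum_le_sum fun j _ => ?_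
      by_cases hj : colSum x j = 0
      · rw [hu1 j hj]
        simpa using sub_le_deficiency (n := n) (m := m) (colSum D j)
      · rw [hu0 j hj]
        have h1 := hbig j hj
        have h2 := deficiency_nonneg (n := n) (m := m) (colSum D j)
        omega
    rw [sum_add_distrib] at hold
    omega

lemma HasRankTwo.lt_of_effective (hn : 2 ≤ n) (hnm : n ≤ m) {D : Fin n × Fin m → ℤ}
    (h : HasRankTwo D) (hD : Effective D) : (n : ℤ) * m - 2 < ∑ v, D v := by
  suffices H : ∀ (N : ℕ) (D : Fin n × Fin m → ℤ), HasRankTwo D → Effective D →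
      ∑ v, D v ≤ (n : ℤ) * m - 2 → ¬ ∑ j, deficiency n m (colSum D j) < N by
    by_contra! hdeg
    refine H ((∑ j, deficiency n m (colSum D j)).toNat + 1) D h hD hdeg ?_
    omega
  intro N
  induction N with
  | zero =>
    intro D _ _ _ hN
    have := sum_nonneg (s := univ) fun j _ => deficiency_nonneg (n := n) (m := m) (colSum D j)
    omega
  | succ N ih =>
    intro D h hD hdeg hN
    obtain ⟨x, hx, hlt⟩ := h.exists_deficiency_lt hn hnm hD hdeg
    refine ih _ (h.sub_rookLap x) (hx.effective_fire hD) ?_ (by push_cast at hN; omega)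
    simpa [sum_sub_distrib, sum_rookLap] using hdeg

/-- Divisors of rank at least two on the rook graph have degree at least `n * m - 1`. -/
lemma RankGE.lt_degD_rook (hn : 2 ≤ n) (hnm : n ≤ m) {D : Fin n × Fin m → ℤ}
    (h : RankGE (rook n m) D 2) : (n : ℤ) * m - 2 < degD D := by
  have hD := h.hasRankTwo
  let v : Fin n × Fin m := (⟨0, by omega⟩, ⟨0, by omega⟩)
  have hE := effective_single_add_single v v
  obtain ⟨f, hf⟩ := hD _ hE (degD_single_add_single v v)
  have := (hD.sub_rookLap f).lt_of_effective hn hnm fun w => by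
    have h1 := hf w
    have h2 := hE w
    simp only [Pi.sub_apply] at *
    linarith
  simpa [degD, sum_sub_distrib, sum_rookLap] using this

lemma exists_single_add {E : Fin n × Fin m → ℤ} (hE : Effective E) (hd : 0 < degD E) :
    ∃ u E', Effective E' ∧ degD E' = degD E - 1 ∧ E = Pi.single u 1 + E' := by
  obtain ⟨u, -, hu⟩ := exists_lt_of_sum_lt (s := univ) (f := fun _ => (0 : ℤ)) (g := E)
    (by rwa [sum_const_zero])
  refine ⟨u, E - Pi.single u 1, fun v => ?_, by simp [degD, sum_sub_distrib], by simp⟩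
  rcases eq_or_ne v u with rfl | hv
  · simp; omega
  · simpa [hv] using hE v

lemma exists_eq_single_add_single {E : Fin n × Fin m → ℤ} (hE : Effective E)
    (hd : degD E = 2) : ∃ u v, E = Pi.single u 1 + Pi.single v 1 := by
  obtain ⟨u, E₁, h1, h2, rfl⟩ := exists_single_add hE (by omega)
  obtain ⟨v, E₂, h3, h4, rfl⟩ := exists_single_add h1 (by omega)
  have : E₂ = 0 := by
    funext w
    exact (sum_eq_zero_iff_of_nonneg fun w _ => h3 w).1 (by rw [degD] at h4; omega) w (mem_univ w)
  exact ⟨u, v, by rw [this, add_zero]⟩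

lemma exists_effective_fire (hn : 2 ≤ n) (hm : 2 ≤ m) (a b : Fin n × Fin m) :
    ∃ A, Effective (fire (rook n m) (1 - Pi.single a 2 - Pi.single b 1) A) := by
  by_cases hrow : a ≠ b ∧ a.1 = b.1
  · refine ⟨univ.filter fun v => v.1 ≠ a.1, fun v => ?_⟩
    have hcol : colSum (indic (univ.filter fun v : Fin n × Fin m => v.1 ≠ a.1)) v.2 = n - 1 := by
      have : ∀ i, (if i = a.1 then (0 : ℤ) else 1) = 1 - if i = a.1 then 1 else 0 := by
        intro i; split_ifs <;> simp
      simp [colSum, indic, this]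
    have hr : rowSum (indic (univ.filter fun v : Fin n × Fin m => v.1 ≠ a.1)) v.1
        = if v.1 = a.1 then 0 else (m : ℤ) := by
      simp [rowSum, indic]
    simp only [fire_rook, Pi.sub_apply, rookLap, hcol, hr]
    by_cases hv : v.1 = a.1
    · have : -1 ≤ (1 - Pi.single a 2 - Pi.single b 1 : Fin n × Fin m → ℤ) v := by
        simp only [Pi.sub_apply, Pi.single_apply, Pi.one_apply]
        split_ifs <;> simp_all
      simp only [Pi.sub_apply] at this
      simp only [indic, mem_filter, hv, ne_eq, not_true, and_false, if_true, if_false]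
      omega
    · have h1 : v ≠ a := fun h => hv (h ▸ rfl)
      have h2 : v ≠ b := fun h => hv (h ▸ hrow.2.symm)
      simp [indic, hv, h1, h2]
  by_cases hcol : a ≠ b ∧ a.2 = b.2
  · refine ⟨univ.filter fun v => v.2 ≠ a.2, fun v => ?_⟩
    have hr : rowSum (indic (univ.filter fun v : Fin n × Fin m => v.2 ≠ a.2)) v.1 = m - 1 := by
      have : ∀ i, (if i = a.2 then (0 : ℤ) else 1) = 1 - if i = a.2 then 1 else 0 := by
        intro i; split_ifs <;> simp
      simp [rowSum, indic, this]
    have hc : colSum (indic (univ.filter fun v : Fin n × Fin m => v.2 ≠ a.2)) v.2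
        = if v.2 = a.2 then 0 else (n : ℤ) := by
      simp [colSum, indic]
    simp only [fire_rook, Pi.sub_apply, rookLap, hc, hr]
    by_cases hv : v.2 = a.2
    · have : -1 ≤ (1 - Pi.single a 2 - Pi.single b 1 : Fin n × Fin m → ℤ) v := by
        simp only [Pi.sub_apply, Pi.single_apply, Pi.one_apply]
        split_ifs <;> simp_all
      simp only [Pi.sub_apply] at this
      simp only [indic, mem_filter, hv, ne_eq, not_true, and_false, if_true, if_false]
      omega
    · have h1 : v ≠ a := fun h => hv (h ▸ rfl)
      have h2 : v ≠ b := fun h => hv (h ▸ hcol.2.symm)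
      simp [indic, hv, h1, h2]
  · refine ⟨{a}ᶜ, fun v => ?_⟩
    have hi : ∀ u, indic ({a}ᶜ : Finset (Fin n × Fin m)) u = 1 - if u = a then 1 else 0 := by
      intro u; by_cases h : u = a <;> simp [indic, h]
    have hc : colSum (indic {a}ᶜ) v.2 = n - if v.2 = a.2 then 1 else 0 := by
      simp [colSum, hi, Prod.ext_iff, ite_and]
    have hr : rowSum (indic {a}ᶜ) v.1 = m - if v.1 = a.1 then 1 else 0 := by
      simp [rowSum, hi, Prod.ext_iff, ite_and]
    simp only [fire_rook, Pi.sub_apply, rookLap, hc, hr, hi, Pi.single_apply, Pi.one_apply]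
    by_cases hva : v = a
    · subst hva
      simp only [if_true]
      split_ifs <;> omega
    · by_cases hvb : v = b
      · subst hvb
        have h1 : v.1 ≠ a.1 := fun h => hrow ⟨Ne.symm hva, h.symm⟩
        have h2 : v.2 ≠ a.2 := fun h => hcol ⟨Ne.symm hva, h.symm⟩
        simp [hva, h1, h2]
      · have h3 : ¬ (v.1 = a.1 ∧ v.2 = a.2) := fun h => hva (Prod.ext h.1 h.2)
        simp only [hva, hvb, if_false]
        split_ifs <;> omega

lemma rankGE_one_sub_single (hn : 2 ≤ n) (hm : 2 ≤ m) (w : Fin n × Fin m) :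
    RankGE (rook n m) (1 - Pi.single w 1) 2 := by
  have hfire : ∀ F : Fin n × Fin m → ℤ, (∃ A, Effective (fire (rook n m) F A)) →
      ∃ D', LinEquiv (rook n m) F D' ∧ Effective D' := fun F ⟨A, hA⟩ =>
    ⟨_, Relation.ReflTransGen.single ⟨A, rfl⟩, hA⟩
  intro E hE hd
  obtain ⟨u, v, rfl⟩ := exists_eq_single_add_single hE (by simpa using hd)
  have htwo : ∀ a : Fin n × Fin m, (Pi.single a 2 : Fin n × Fin m → ℤ)
      = Pi.single a 1 + Pi.single a 1 := fun a => by rw [← Pi.single_add]; rfl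
  by_cases huv : u = v
  · obtain ⟨A, hA⟩ := exists_effective_fire hn hm u w
    refine hfire _ ⟨A, ?_⟩
    convert hA using 2
    rw [htwo, huv]; abel
  by_cases huw : u = w
  · obtain ⟨A, hA⟩ := exists_effective_fire hn hm u v
    refine hfire _ ⟨A, ?_⟩
    convert hA using 2
    rw [htwo, huw]; abel
  by_cases hvw : v = w
  · obtain ⟨A, hA⟩ := exists_effective_fire hn hm v u
    refine hfire _ ⟨A, ?_⟩
    convert hA using 2
    rw [htwo, hvw]; abel
  refine ⟨_, Relation.ReflTransGen.refl, fun z => ?_⟩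
  simp only [Pi.sub_apply, Pi.add_apply, Pi.one_apply, Pi.single_apply]
  split_ifs <;> simp_all

end RookGonality

/-- For `2 ≤ n ≤ m`, the `2`-gonality of `K_n □ K_m` equals `n * m - 1`. -/
theorem two_gonality_rook (n m : ℕ) (hn : 2 ≤ n) (hnm : n ≤ m) :
    kGonality (rook n m) 2 = n * m - 1 := by
  have hpos : 1 ≤ n * m := Nat.mul_pos (by omega) (by omega)
  have hmem : n * m - 1 ∈
      {d : ℕ | ∃ D : Fin n × Fin m → ℤ, RankGE (rook n m) D 2 ∧ degD D = (d : ℤ)} := by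
    refine ⟨_, rankGE_one_sub_single hn (hn.trans hnm) (⟨0, by omega⟩, ⟨0, by omega⟩), ?_⟩
    simp [degD, Finset.sum_sub_distrib, Nat.cast_sub hpos]
  refine le_antisymm (Nat.sInf_le hmem) (le_csInf ⟨_, hmem⟩ ?_)
  rintro d ⟨D, hD, hd⟩
  have h1 := hD.lt_degD_rook hn hnm
  rw [hd] at h1
  have h2 : ((n * m : ℕ) : ℤ) - 2 < d := by push_cast; exact h1
  omega
end

section
/- Let 2 ≤ n ≤ m. The divisor on the rook graph K_n □ K_m that places exactly one chip on every vertex (which has degree n·m) has rank at least 3. -/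
theorem rook_adj_s19 {n m : ℕ} {u v : Fin n × Fin m} :
    (rook n m).Adj u v ↔ (u.1 ≠ v.1 ∧ u.2 = v.2) ∨ (u.2 ≠ v.2 ∧ u.1 = v.1) := by
  simp [rook, SimpleGraph.boxProd_adj]

theorem edgesTo_le_one {V : Type*} [DecidableEq V] {G : SimpleGraph V} [DecidableRel G.Adj]
    {v w : V} {S : Finset V} (h : ∀ u ∈ S, G.Adj v u → u = w) : edgesTo G v S ≤ 1 := by
  refine (Finset.card_le_card (t := {w}) fun u hu => ?_).trans (Finset.card_singleton w).le
  rw [Finset.mem_filter] at hu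
  exact Finset.mem_singleton.2 (h u hu.1 hu.2)

theorem one_le_edgesTo {V : Type*} [DecidableEq V] {G : SimpleGraph V} [DecidableRel G.Adj]
    {v w : V} {S : Finset V} (hw : w ∈ S) (h : G.Adj v w) : 1 ≤ edgesTo G v S :=
  Finset.card_pos.2 ⟨w, Finset.mem_filter.2 ⟨hw, h⟩⟩

theorem two_le_edgesTo {V : Type*} [DecidableEq V] {G : SimpleGraph V} [DecidableRel G.Adj]
    {v w x : V} {S : Finset V} (hwx : w ≠ x) (hw : w ∈ S) (hx : x ∈ S) (h : G.Adj v w)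
    (h' : G.Adj v x) : 2 ≤ edgesTo G v S := by
  rw [← Finset.card_pair hwx]
  refine Finset.card_le_card fun u hu => ?_
  rcases Finset.mem_insert.1 hu with rfl | hu
  · exact Finset.mem_filter.2 ⟨hw, h⟩
  · rw [Finset.mem_singleton.1 hu]
    exact Finset.mem_filter.2 ⟨hx, h'⟩

/-- Firing the complement of `S` turns `D` into an effective divisor as soon as the vertices
outside `S` can afford it and those in `S` gain enough chips. -/
theorem exists_effective_of_fire_compl {V : Type*} [Fintype V] [DecidableEq V]
    (G : SimpleGraph V) [DecidableRel G.Adj] (D : V → ℤ) (S : Finset V)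
    (hout : ∀ v ∉ S, (edgesTo G v S : ℤ) ≤ D v)
    (hin : ∀ v ∈ S, 0 ≤ D v + edgesTo G v Sᶜ) :
    ∃ D', LinEquiv G D D' ∧ Effective D' := by
  refine ⟨fire G D Sᶜ, .single ⟨Sᶜ, rfl⟩, fun v => ?_⟩
  by_cases hv : v ∈ S
  · simpa [fire, hv] using hin v hv
  · simpa [fire, hv] using hout v hv

theorem Effective.add_le_degD {V : Type*} [Fintype V] [DecidableEq V] {E : V → ℤ}
    (hE : Effective E) {p q : V} (hpq : p ≠ q) : E p + E q ≤ degD E := by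
  rw [← Finset.sum_pair hpq]
  exact Finset.sum_le_univ_sum_of_nonneg hE

theorem Effective.add_add_le_degD {V : Type*} [Fintype V] [DecidableEq V] {E : V → ℤ}
    (hE : Effective E) {p q r : V} (hpq : p ≠ q) (hpr : p ≠ r) (hqr : q ≠ r) :
    E p + E q + E r ≤ degD E := by
  have h : ∑ v ∈ {p, q, r}, E v = E p + E q + E r := by
    rw [Finset.sum_insert (by simp [hpq, hpr]), Finset.sum_pair hqr, add_assoc]
  rw [← h]
  exact Finset.sum_le_univ_sum_of_nonneg hE

/-- For `2 ≤ n ≤ m`, the all-ones divisor on `K_n □ K_m`, which has degree `n * m`,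
has rank at least `3`. -/
theorem all_ones_rank_ge_three (n m : ℕ) (hn : 2 ≤ n) (hnm : n ≤ m) :
    degD (fun _ : Fin n × Fin m => (1 : ℤ)) = ((n * m : ℕ) : ℤ) ∧
    RankGE (rook n m) (fun _ : Fin n × Fin m => (1 : ℤ)) 3 := by
  have : Nontrivial (Fin n) := Fin.nontrivial_iff_two_le.2 hn
  have : Nontrivial (Fin m) := Fin.nontrivial_iff_two_le.2 (hn.trans hnm)
  refine ⟨by simp [degD], fun E hE hdeg => ?_⟩
  push_cast at hdeg
  by_cases hle : ∀ v, E v ≤ 1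
  · exact ⟨_, .refl, fun v => sub_nonneg.2 (hle v)⟩
  push Not at hle
  obtain ⟨p, hp⟩ := hle
  have hp3 : E p ≤ 3 := hdeg ▸ Finset.single_le_sum (fun v _ => hE v) (Finset.mem_univ p)
  have hpair : ∀ v, v ≠ p → E v ≤ 1 := fun v hv => by
    have := hE.add_le_degD hv
    omega
  by_cases hnbr : ∃ q, (rook n m).Adj p q ∧ 0 < E q
  · obtain ⟨q, hpq, hq⟩ := hnbr
    have hne : p ≠ q := hpq.ne
    have htwo : ∀ v, E v ≤ 2 := fun v => by
      have h := hE.add_le_degD hne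
      by_cases hv : v = p
      · subst hv; omega
      · have := hpair v hv; omega
    have hzero : ∀ v, v ≠ p → v ≠ q → E v ≤ 0 := fun v hvp hvq => by
      have := hE.add_add_le_degD hne hvp.symm hvq.symm
      omega
    rcases rook_adj_s19.1 hpq with ⟨-, h⟩ | ⟨-, h⟩
    · refine exists_effective_of_fire_compl _ _ (Finset.univ.filter fun v => v.2 = p.2) ?_ ?_
      · intro v hv
        have hv' : v.2 ≠ p.2 := by simpa using hv
        have h0 := hzero v (fun e => hv' (e ▸ rfl)) (fun e => hv' (e ▸ h.symm))
        have h1 : edgesTo (rook n m) v (Finset.univ.filter fun v => v.2 = p.2) ≤ 1 := by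
          refine edgesTo_le_one (w := (v.1, p.2)) fun u hu hvu => ?_
          have hu' : u.2 = p.2 := by simpa using hu
          rw [rook_adj_s19] at hvu
          ext1 <;> grind
        simp only [Pi.sub_apply]
        omega
      · intro v hv
        have hv' : v.2 = p.2 := by simpa using hv
        obtain ⟨j, hj⟩ := exists_ne p.2
        have h1 : 1 ≤ edgesTo (rook n m) v (Finset.univ.filter fun v => v.2 = p.2)ᶜ :=
          one_le_edgesTo (w := (v.1, j)) (by simpa using hj)
            (rook_adj_s19.2 (.inr ⟨by simpa [hv'] using hj.symm, rfl⟩))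
        have := htwo v
        simp only [Pi.sub_apply]
        omega
    · refine exists_effective_of_fire_compl _ _ (Finset.univ.filter fun v => v.1 = p.1) ?_ ?_
      · intro v hv
        have hv' : v.1 ≠ p.1 := by simpa using hv
        have h0 := hzero v (fun e => hv' (e ▸ rfl)) (fun e => hv' (e ▸ h.symm))
        have h1 : edgesTo (rook n m) v (Finset.univ.filter fun v => v.1 = p.1) ≤ 1 := by
          refine edgesTo_le_one (w := (p.1, v.2)) fun u hu hvu => ?_
          have hu' : u.1 = p.1 := by simpa using hu
          rw [rook_adj_s19] at hvu
          ext1 <;> grind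
        simp only [Pi.sub_apply]
        omega
      · intro v hv
        have hv' : v.1 = p.1 := by simpa using hv
        obtain ⟨i, hi⟩ := exists_ne p.1
        have h1 : 1 ≤ edgesTo (rook n m) v (Finset.univ.filter fun v => v.1 = p.1)ᶜ :=
          one_le_edgesTo (w := (i, v.2)) (by simpa using hi)
            (rook_adj_s19.2 (.inl ⟨by simpa [hv'] using hi.symm, rfl⟩))
        have := htwo v
        simp only [Pi.sub_apply]
        omega
  · push Not at hnbr
    refine exists_effective_of_fire_compl _ _ {p} ?_ ?_
    · intro v hv
      have hvp : v ≠ p := by simpa using hv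
      by_cases hadj : (rook n m).Adj p v
      · have h0 := hnbr v hadj
        have h1 : edgesTo (rook n m) v {p} ≤ 1 :=
          edgesTo_le_one fun u hu _ => Finset.mem_singleton.1 hu
        simp only [Pi.sub_apply]
        omega
      · have h0 : edgesTo (rook n m) v {p} = 0 := by
          simp [edgesTo, Finset.filter_singleton, SimpleGraph.adj_comm _ v p, hadj]
        have := hpair v hvp
        simp only [Pi.sub_apply]
        omega
    · intro v hv
      obtain rfl := Finset.mem_singleton.1 hv
      obtain ⟨i, hi⟩ := exists_ne v.1
      obtain ⟨j, hj⟩ := exists_ne v.2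
      have h2 : 2 ≤ edgesTo (rook n m) v {v}ᶜ :=
        two_le_edgesTo (w := (i, v.2)) (x := (v.1, j)) (by simp [hi]) (by simp [Prod.ext_iff, hi])
          (by simp [Prod.ext_iff, hj]) (rook_adj_s19.2 (.inl ⟨hi.symm, rfl⟩))
          (rook_adj_s19.2 (.inr ⟨hj.symm, rfl⟩))
      simp only [Pi.sub_apply]
      omega
end
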